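/- arXiv:2412.09576 — 7 statements merged into one kernel-verified Lean document; each statement's English description precedes it below -/
import Mathlib

section
/- Let D, N, M, M' be natural numbers with M' ≤ M ≤ N ≤ D, let E be a finite family of N-element subsets of Fin D, and let x : E → ℝ satisfy the level-M uniformity condition: for every M-element subset S of Fin D, ∑_{e ∈ E, S ⊆ e} x_e = (N.choose M : ℝ) / (D.choose M). Then x also satisfies the level-M' uniformity condition: for every M'-element subset T of Fin D, ∑_{e ∈ E, T ⊆ e} x_e = (N.choose M' : ℝ) / (D.choose M'). -/
/-- Double counting of the pairs `T ⊆ S ⊆ e` with `S.card = m`, weighted by `x e`. -/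
theorem sum_powersetCard_sum_filter_subset {α R : Type*} [Fintype α] [DecidableEq α] [Semiring R]
    {n m : ℕ} (E : Finset (Finset α)) (hE : ∀ e ∈ E, e.card = n) (x : Finset α → R)
    (T : Finset α) (hT : T.card ≤ m) :
    ∑ S ∈ Finset.univ.powersetCard m with T ⊆ S, ∑ e ∈ E with S ⊆ e, x e =
      ((n - T.card).choose (m - T.card) : R) * ∑ e ∈ E with T ⊆ e, x e := by
  rw [Finset.sum_comm' (t' := E.filter (T ⊆ ·))
    (s' := fun e => (e.powersetCard m).filter (T ⊆ ·)), Finset.mul_sum]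
  · refine Finset.sum_congr rfl fun e he => ?_
    rw [Finset.mem_filter] at he
    rw [Finset.sum_const, Finset.card_filter_powersetCard_subset _ _ _ he.2 hT, hE e he.1,
      nsmul_eq_mul]
  · intro S e
    simp only [Finset.mem_filter, Finset.mem_powersetCard, Finset.subset_univ, true_and]
    exact ⟨fun ⟨⟨hS, hTS⟩, he, hSe⟩ => ⟨⟨⟨hSe, hS⟩, hTS⟩, he, hTS.trans hSe⟩,
      fun ⟨⟨⟨hSe, hS⟩, hTS⟩, he, _⟩ => ⟨⟨hS, hTS⟩, he, hSe⟩⟩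

/-- Nesting property: if the weights `x` satisfy the level-`M` uniformity
condition, then they satisfy the level-`M'` one for every `M' ≤ M`. -/
theorem uniformity_nesting (D N M M' : ℕ) (hM'M : M' ≤ M) (hMN : M ≤ N)
    (hND : N ≤ D)
    (E : Finset (Finset (Fin D))) (hN : ∀ e ∈ E, e.card = N)
    (x : Finset (Fin D) → ℝ)
    (hx : ∀ S : Finset (Fin D), S.card = M →
      ∑ e ∈ E.filter (fun e => S ⊆ e), x e = (N.choose M : ℝ) / (D.choose M)) :
    ∀ T : Finset (Fin D), T.card = M' →
      ∑ e ∈ E.filter (fun e => T ⊆ e), x e =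
        (N.choose M' : ℝ) / (D.choose M') := by
  intro T hT
  have hcount := sum_powersetCard_sum_filter_subset E hN x T (hT.trans_le hM'M)
  rw [Finset.sum_congr rfl fun S hS => hx S
      (Finset.mem_powersetCard.mp (Finset.mem_filter.mp hS).1).2,
    Finset.sum_const, Finset.card_filter_powersetCard_subset _ _ _ (Finset.subset_univ T)
      (hT.trans_le hM'M), Finset.card_univ, Fintype.card_fin, hT, nsmul_eq_mul] at hcount
  have hNchoose : (N.choose M * M.choose M' : ℝ) = N.choose M' * (N - M').choose (M - M') :=
    mod_cast Nat.choose_mul hM'M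
  have hDchoose : (D.choose M * M.choose M' : ℝ) = D.choose M' * (D - M').choose (M - M') :=
    mod_cast Nat.choose_mul hM'M
  have hDM : (D.choose M : ℝ) ≠ 0 := mod_cast (Nat.choose_pos (hMN.trans hND)).ne'
  have hDM' : (D.choose M' : ℝ) ≠ 0 :=
    mod_cast (Nat.choose_pos (hM'M.trans (hMN.trans hND))).ne'
  have hNM : ((N - M').choose (M - M') : ℝ) ≠ 0 :=
    mod_cast (Nat.choose_pos (Nat.sub_le_sub_right hMN M')).ne'
  apply mul_left_cancel₀ hNM
  rw [← hcount]
  field_simp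
  linear_combination (N.choose M : ℝ) * -hDchoose + (D.choose M : ℝ) * hNchoose
end

section
/- Let D, N, M be natural numbers with M ≤ N ≤ D, let E be a finite family of N-element subsets of Fin D, and let x : E → ℝ satisfy the level-M uniformity condition: for every M-element subset S of Fin D, ∑_{e ∈ E, S ⊆ e} x_e = (N.choose M : ℝ) / (D.choose M). Then x satisfies the complementary level-M uniformity condition: for every M-element subset S of Fin D, ∑_{e ∈ E, S ⊆ (Fin D) \ e} x_e = ((D - N).choose M : ℝ) / (D.choose M). -/
open Finset in
/-- Uniformity at level `m + 1` of an `N`-uniform weighted family implies uniformity at level `m`. -/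
theorem uniformity_of_succ {α : Type*} [Fintype α] [DecidableEq α] {N m : ℕ} (hmN : m < N)
    {E : Finset (Finset α)} (hE : ∀ e ∈ E, e.card = N) {x : Finset α → ℝ} {c : ℝ}
    (hx : ∀ S : Finset α, S.card = m + 1 →
      ∑ e ∈ E with S ⊆ e, x e = (Fintype.card α - (m + 1)).choose (N - (m + 1)) / c)
    (S : Finset α) (hS : S.card = m) :
    ∑ e ∈ E with S ⊆ e, x e = (Fintype.card α - m).choose (N - m) / c := by
  have hsum : ∑ v ∈ Sᶜ, ∑ e ∈ E with insert v S ⊆ e, x e =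
      (N - m : ℕ) * ∑ e ∈ E with S ⊆ e, x e := by
    simp_rw [sum_filter, mul_sum]
    rw [sum_comm]
    refine sum_congr rfl fun e he => ?_
    by_cases hSe : S ⊆ e
    · have hcard : (Sᶜ.filter fun v => insert v S ⊆ e).card = N - m := by
        rw [← hE e he, ← hS, ← card_sdiff_of_subset hSe]
        congr 1
        ext v
        simp [insert_subset_iff, hSe, and_comm]
      rw [← sum_filter, sum_const, hcard, nsmul_eq_mul, if_pos hSe]
    · simp [insert_subset_iff, hSe]
  have hconst : ∑ v ∈ Sᶜ, ∑ e ∈ E with insert v S ⊆ e, x e =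
      (Fintype.card α - m : ℕ) *
        ((Fintype.card α - (m + 1)).choose (N - (m + 1)) / c) := by
    rw [sum_congr rfl fun v hv => hx (insert v S) (by
      rw [card_insert_of_notMem (mem_compl.mp hv), hS]), sum_const, card_compl, hS, nsmul_eq_mul]
  have hchoose : (Fintype.card α - m) * (Fintype.card α - (m + 1)).choose (N - (m + 1)) =
      (N - m) * (Fintype.card α - m).choose (N - m) := by
    obtain ⟨k, hk⟩ : ∃ k, N - m = k + 1 := ⟨N - m - 1, by omega⟩
    rw [← Nat.sub_sub, ← Nat.sub_sub, hk]
    cases Fintype.card α - m with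
    | zero => simp
    | succ n => simpa [mul_comm] using Nat.add_one_mul_choose_eq n k
  have hpos : ((N - m : ℕ) : ℝ) ≠ 0 := by
    exact_mod_cast (Nat.sub_pos_of_lt hmN).ne'
  apply mul_left_cancel₀ hpos
  rw [← hsum, hconst, ← mul_div_assoc, ← mul_div_assoc]
  exact_mod_cast congrArg (fun n : ℕ => (n : ℝ) / c) hchoose

/-- Uniformity at level `M` of an `N`-uniform weighted family implies uniformity at every lower
level. -/
theorem uniformity_of_le {α : Type*} [Fintype α] [DecidableEq α] {N M m : ℕ} (hMN : M ≤ N)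
    (hmM : m ≤ M) {E : Finset (Finset α)} (hE : ∀ e ∈ E, e.card = N) {x : Finset α → ℝ} {c : ℝ}
    (hx : ∀ S : Finset α, S.card = M →
      ∑ e ∈ E with S ⊆ e, x e = (Fintype.card α - M).choose (N - M) / c)
    (S : Finset α) (hS : S.card = m) :
    ∑ e ∈ E with S ⊆ e, x e = (Fintype.card α - m).choose (N - m) / c := by
  induction hmM using Nat.decreasingInduction generalizing S with
  | self => exact hx S hS
  | of_succ k hk ih => exact uniformity_of_succ (hk.trans_le hMN) hE ih S hS

open Finset in
/-- In an `N`-uniform weighted family that is uniform at level `M ≤ N`, the total weight of the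
edges containing `A` and avoiding `B` depends only on the cardinalities of the disjoint sets `A`
and `B`, as long as they have at most `M` elements together. -/
theorem sum_subset_disjoint_of_uniformity {α : Type*} [Fintype α] [DecidableEq α] {N M : ℕ}
    (hMN : M ≤ N) {E : Finset (Finset α)} (hE : ∀ e ∈ E, e.card = N) {x : Finset α → ℝ} {c : ℝ}
    (hx : ∀ S : Finset α, S.card = M →
      ∑ e ∈ E with S ⊆ e, x e = (Fintype.card α - M).choose (N - M) / c)
    (A B : Finset α) (hAB : Disjoint A B) (hM : A.card + B.card ≤ M) :
    ∑ e ∈ E with A ⊆ e ∧ Disjoint B e, x e =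
      (Fintype.card α - (A.card + B.card)).choose (N - A.card) / c := by
  induction B using Finset.induction_on generalizing A with
  | empty => simpa using uniformity_of_le hMN (by simpa using hM) hE hx A rfl
  | insert v B hv ih =>
    obtain ⟨hvA, hAB⟩ := disjoint_insert_right.mp hAB
    rw [card_insert_of_notMem hv] at hM ⊢
    have hwithout := ih A hAB (by omega)
    have hwith := ih (insert v A) (disjoint_insert_left.mpr ⟨hv, hAB⟩)
      (by rw [card_insert_of_notMem hvA]; omega)
    rw [card_insert_of_notMem hvA] at hwith
    have hsplit : ∑ e ∈ E with A ⊆ e ∧ Disjoint B e, x e =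
        ∑ e ∈ E with insert v A ⊆ e ∧ Disjoint B e, x e +
          ∑ e ∈ E with A ⊆ e ∧ Disjoint (insert v B) e, x e := by
      simp_rw [sum_filter]
      rw [← sum_add_distrib]
      refine sum_congr rfl fun e _ => ?_
      by_cases hve : v ∈ e <;> simp [insert_subset_iff, hve]
    have hcard : A.card + (B.card + 1) ≤ Fintype.card α := by
      rw [← card_insert_of_notMem hv, ← card_union_of_disjoint
        (disjoint_insert_right.mpr ⟨hvA, hAB⟩)]
      exact card_le_univ _
    have hpascal : (Fintype.card α - (A.card + B.card)).choose (N - A.card) =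
        (Fintype.card α - (A.card + 1 + B.card)).choose (N - (A.card + 1)) +
          (Fintype.card α - (A.card + (B.card + 1))).choose (N - A.card) := by
      obtain ⟨k, hk⟩ : ∃ k, N - A.card = k + 1 := ⟨N - A.card - 1, by omega⟩
      obtain ⟨n, hn⟩ : ∃ n, Fintype.card α - (A.card + B.card) = n + 1 :=
        ⟨Fintype.card α - (A.card + B.card) - 1, by omega⟩
      rw [show Fintype.card α - (A.card + 1 + B.card) = n by omega,
        show Fintype.card α - (A.card + (B.card + 1)) = n by omega,
        show N - (A.card + 1) = k by omega, hk, hn, Nat.choose_succ_succ']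
    rw [hwithout, hwith, hpascal, Nat.cast_add, add_div] at hsplit
    exact (add_left_cancel hsplit).symm

/-- Choosing disjoint sets of sizes `a` and `b` out of `n` elements can be done in either order. -/
theorem choose_mul_choose_sub_comm (n a b : ℕ) :
    n.choose a * (n - a).choose b = n.choose b * (n - b).choose a := by
  have ha := Nat.choose_mul (n := n) (Nat.le_add_right a b)
  have hb := Nat.choose_mul (n := n) (Nat.le_add_left b a)
  rw [Nat.add_sub_cancel_left] at ha
  rw [Nat.add_sub_cancel] at hb
  rw [← ha, ← hb, Nat.choose_symm_add]

/-- Particle-hole symmetry for the uniformity condition: if `x` satisfies the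
level-`M` uniformity condition for the `N`-uniform family `E`, then it
satisfies the complementary level-`M` uniformity condition. -/
theorem uniformity_particle_hole (D N M : ℕ) (hMN : M ≤ N) (hND : N ≤ D)
    (E : Finset (Finset (Fin D))) (hN : ∀ e ∈ E, e.card = N)
    (x : Finset (Fin D) → ℝ)
    (hx : ∀ S : Finset (Fin D), S.card = M →
      ∑ e ∈ E.filter (fun e => S ⊆ e), x e = (N.choose M : ℝ) / (D.choose M)) :
    ∀ S : Finset (Fin D), S.card = M →
      ∑ e ∈ E.filter (fun e => S ⊆ eᶜ), x e =
        ((D - N).choose M : ℝ) / (D.choose M) := by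
  intro S hS
  have hDN : (D.choose N : ℝ) ≠ 0 := by exact_mod_cast (Nat.choose_pos hND).ne'
  have hDM : (D.choose M : ℝ) ≠ 0 := by exact_mod_cast (Nat.choose_pos (hMN.trans hND)).ne'
  have hx' : ∀ T : Finset (Fin D), T.card = M →
      ∑ e ∈ E with T ⊆ e, x e =
        (Fintype.card (Fin D) - M).choose (N - M) / (D.choose N : ℝ) := by
    intro T hT
    rw [hx T hT, Fintype.card_fin, div_eq_div_iff hDM hDN]
    norm_cast
    rw [mul_comm, Nat.choose_mul hMN, mul_comm]
  have hsum := sum_subset_disjoint_of_uniformity hMN hN hx' ∅ S (by simp) (by simp [hS])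
  simp only [Finset.empty_subset, true_and, Finset.card_empty, zero_add, hS, Fintype.card_fin,
    tsub_zero] at hsum
  simp_rw [Finset.subset_compl_iff_disjoint_right]
  rw [hsum, div_eq_div_iff hDN hDM]
  norm_cast
  rw [mul_comm, choose_mul_choose_sub_comm, mul_comm]
end

section
/- Let D, N, M be natural numbers with M ≤ D and N ≤ D. Then in ℚ: ∑_{k=0}^{M} (-1)^k * (M.choose k) * (N.choose k) / (D.choose k) = ((D - N).choose M : ℚ) / (D.choose M). -/
/-- Inclusion–exclusion for the `M`-subsets of a `D`-set that avoid a fixed `N`-subset. -/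
theorem sum_neg_one_pow_mul_choose_mul_choose_sub {R : Type*} [CommRing R] {N D : ℕ}
    (hN : N ≤ D) (M : ℕ) :
    ∑ k ∈ Finset.range (M + 1),
      (-1 : R) ^ k * (N.choose k : R) * ((D - k).choose (M - k) : R) =
      ((D - N).choose M : R) := by
  induction N generalizing D M with
  | zero => simp [Finset.sum_range_succ']
  | succ N ih =>
    obtain ⟨D, rfl⟩ : ∃ d, D = d + 1 := ⟨D - 1, by omega⟩
    cases M with
    | zero => simp
    | succ M =>
      have h₁ := ih (D := D + 1) (by omega) (M + 1)
      have h₂ := ih (D := D) (by omega) M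
      rw [Nat.sub_add_comm (by omega : N ≤ D), Nat.choose_succ_succ, Nat.cast_add, ← h₂,
        Finset.sum_range_succ'] at h₁
      rw [Finset.sum_range_succ']
      simp only [Nat.choose_succ_succ N, Nat.cast_add, Nat.add_sub_add_right, pow_succ, mul_add,
        add_mul, mul_neg, mul_one, neg_mul, Finset.sum_add_distrib, Finset.sum_neg_distrib,
        Nat.succ_eq_add_one, Nat.choose_zero_right] at h₁ ⊢
      linear_combination h₁

/-- Terminating Chu–Vandermonde identity:
`∑_{k=0}^{M} (-1)^k C(M,k) C(N,k) / C(D,k) = C(D-N, M) / C(D, M)` in `ℚ`. -/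
theorem chu_vandermonde_terminating (D N M : ℕ) (hM : M ≤ D) (hN : N ≤ D) :
    ∑ k ∈ Finset.range (M + 1),
      (-1 : ℚ) ^ k * (M.choose k : ℚ) * (N.choose k : ℚ) / (D.choose k : ℚ) =
      ((D - N).choose M : ℚ) / (D.choose M : ℚ) := by
  rw [← sum_neg_one_pow_mul_choose_mul_choose_sub hN M, Finset.sum_div]
  refine Finset.sum_congr rfl fun k hk => ?_
  have hkM : k ≤ M := Finset.mem_range_succ_iff.mp hk
  have hDk : (D.choose k : ℚ) ≠ 0 := by exact_mod_cast (Nat.choose_pos (hkM.trans hM)).ne'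
  have hDM : (D.choose M : ℚ) ≠ 0 := by exact_mod_cast (Nat.choose_pos hM).ne'
  have h : (D.choose M : ℚ) * M.choose k = D.choose k * (D - k).choose (M - k) := by
    exact_mod_cast Nat.choose_mul hkM
  rw [div_eq_div_iff hDk hDM]
  linear_combination (-1 : ℚ) ^ k * N.choose k * h
end

section
/- For all natural numbers D, M₁, M₂, M₃ with M₁ + M₂ + M₃ ≤ D, the binomial coefficients satisfy (D.choose (M₁ + M₂ + M₃)) * (D.choose M₃) ≤ (D.choose (M₁ + M₃)) * (D.choose (M₂ + M₃)). -/
/-- Strong subadditivity inequality for binomial coefficients: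
`C(D, M₁+M₂+M₃) * C(D, M₃) ≤ C(D, M₁+M₃) * C(D, M₂+M₃)` when
`M₁ + M₂ + M₃ ≤ D`. -/
theorem choose_strong_subadditivity (D M₁ M₂ M₃ : ℕ) (h : M₁ + M₂ + M₃ ≤ D) :
    D.choose (M₁ + M₂ + M₃) * D.choose M₃ ≤
      D.choose (M₁ + M₃) * D.choose (M₂ + M₃) := by
  have h₁ : D.choose (M₁ + M₂ + M₃) * (M₁ + M₂ + M₃).choose M₁ =
      D.choose (M₂ + M₃) * (D - (M₂ + M₃)).choose M₁ := by
    have := Nat.choose_mul (n := D) (k := M₁ + M₂ + M₃) (s := M₂ + M₃) (by omega)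
    rwa [show M₁ + M₂ + M₃ - (M₂ + M₃) = M₁ by omega,
      ← Nat.choose_symm_of_eq_add (add_assoc M₁ M₂ M₃)] at this
  have h₂ : D.choose (M₁ + M₃) * (M₁ + M₃).choose M₁ = D.choose M₃ * (D - M₃).choose M₁ := by
    have := Nat.choose_mul (n := D) (k := M₁ + M₃) (s := M₃) (by omega)
    rwa [Nat.add_sub_cancel, ← Nat.choose_symm_add] at this
  have hpos : 0 < (M₁ + M₂ + M₃).choose M₁ * (D - M₃).choose M₁ :=
    Nat.mul_pos (Nat.choose_pos (by omega)) (Nat.choose_pos (by omega))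
  refine Nat.le_of_mul_le_mul_right ?_ hpos
  calc
    D.choose (M₁ + M₂ + M₃) * D.choose M₃ *
          ((M₁ + M₂ + M₃).choose M₁ * (D - M₃).choose M₁)
        = (D.choose (M₁ + M₂ + M₃) * (M₁ + M₂ + M₃).choose M₁) *
          (D.choose M₃ * (D - M₃).choose M₁) := by ring
    _ = D.choose (M₁ + M₃) * D.choose (M₂ + M₃) *
          ((M₁ + M₃).choose M₁ * (D - (M₂ + M₃)).choose M₁) := by rw [h₁, ← h₂]; ring
    _ ≤ D.choose (M₁ + M₃) * D.choose (M₂ + M₃) *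
          ((M₁ + M₂ + M₃).choose M₁ * (D - M₃).choose M₁) :=
        Nat.mul_le_mul_left _ (Nat.mul_le_mul (Nat.choose_le_choose _ (by omega))
          (Nat.choose_le_choose _ (by omega)))
end

section
/- Let D, M be natural numbers with 1 ≤ M and 2M ≤ D, and set N = 2M. Let E be a finite family of N-element subsets of Fin D such that any two distinct members of E intersect in strictly fewer than M elements. Suppose there exist weights x : E → ℝ with x_e ≥ 0 for all e and satisfying the level-M uniformity condition: for every M-element subset S of Fin D, ∑_{e ∈ E, S ⊆ e} x_e = (N.choose M : ℝ) / (D.choose M). Then every M-element subset of Fin D is contained in exactly one member of E, i.e., E is a Steiner system S(M, 2M, D). -/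
/-- At equal bipartitioning `N = 2M`, any family satisfying the overlap
criterion and admitting nonnegative weights meeting the level-`M` uniformity
condition must be a Steiner system `S(M, 2M, D)`: every `M`-subset lies in
exactly one edge. -/
theorem steiner_at_equal_bipartition (D M : ℕ) (hM : 1 ≤ M) (hD : 2 * M ≤ D)
    (E : Finset (Finset (Fin D))) (hN : ∀ e ∈ E, e.card = 2 * M)
    (hover : ∀ e₁ ∈ E, ∀ e₂ ∈ E, e₁ ≠ e₂ → (e₁ ∩ e₂).card < M)
    (x : Finset (Fin D) → ℝ) (hxnonneg : ∀ e ∈ E, 0 ≤ x e)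
    (hx : ∀ S : Finset (Fin D), S.card = M →
      ∑ e ∈ E.filter (fun e => S ⊆ e), x e =
        ((2 * M).choose M : ℝ) / (D.choose M)) :
    ∀ S : Finset (Fin D), S.card = M →
      (E.filter (fun e => S ⊆ e)).card = 1 := by
  intro S hS
  have hpos : (0 : ℝ) < ((2 * M).choose M : ℝ) / (D.choose M) :=
    div_pos (by exact_mod_cast Nat.choose_pos (by omega))
      (by exact_mod_cast Nat.choose_pos (by omega))
  apply le_antisymm
  · rw [Finset.card_le_one]
    intro e₁ h₁ e₂ h₂
    rw [Finset.mem_filter] at h₁ h₂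
    by_contra hne
    have hlt := hover e₁ h₁.1 e₂ h₂.1 hne
    have hle := Finset.card_le_card (Finset.subset_inter h₁.2 h₂.2)
    omega
  · rw [Nat.one_le_iff_ne_zero, Finset.card_ne_zero]
    apply Finset.nonempty_of_sum_ne_zero (f := x)
    rw [hx S hS]
    exact hpos.ne'
end

section
/- Let D be an odd natural number with D ≥ 1. Then there is no finite family E of pairwise disjoint 2-element subsets of Fin D together with weights x : E → ℝ such that for every vertex i ∈ Fin D, ∑_{e ∈ E, i ∈ e} x_e = (2 : ℝ) / D. -/
/-- A finite type partitioned into 2-element sets has an even number of elements. -/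
theorem even_card_of_pairwise_disjoint_pairs {α : Type*} [Fintype α] [DecidableEq α]
    {E : Finset (Finset α)} (hcard : ∀ e ∈ E, e.card = 2)
    (hdisj : ∀ e₁ ∈ E, ∀ e₂ ∈ E, e₁ ≠ e₂ → Disjoint e₁ e₂)
    (hcover : ∀ i, ∃ e ∈ E, i ∈ e) : Even (Fintype.card α) := by
  have huniv : E.biUnion (fun e => e) = Finset.univ := by
    ext i
    simpa using hcover i
  rw [← Finset.card_univ, ← huniv, Finset.card_biUnion hdisj, Finset.sum_congr rfl hcard]
  simp

/-- For odd `D`, there is no family of pairwise disjoint 2-element subsets of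
`Fin D` with weights satisfying the level-1 uniformity condition
`∑_{e ∋ i} x_e = 2 / D` at every vertex `i`. -/
theorem no_maximally_entangled_two_fermion_odd (D : ℕ) (hodd : Odd D)
    (hD : 1 ≤ D) :
    ¬ ∃ (E : Finset (Finset (Fin D))) (x : Finset (Fin D) → ℝ),
      (∀ e ∈ E, e.card = 2) ∧
      (∀ e₁ ∈ E, ∀ e₂ ∈ E, e₁ ≠ e₂ → Disjoint e₁ e₂) ∧
      (∀ i : Fin D, ∑ e ∈ E.filter (fun e => i ∈ e), x e = (2 : ℝ) / D) := by
  rintro ⟨E, x, hcard, hdisj, hsum⟩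
  refine Nat.not_even_iff_odd.mpr hodd ?_
  rw [← Fintype.card_fin D]
  refine even_card_of_pairwise_disjoint_pairs hcard hdisj fun i => ?_
  have hD' : (D : ℝ) ≠ 0 := Nat.cast_ne_zero.mpr (by lia)
  have hne : ∑ e ∈ E.filter (fun e => i ∈ e), x e ≠ 0 := by
    rw [hsum i]
    exact div_ne_zero two_ne_zero hD'
  obtain ⟨e, he, -⟩ := Finset.exists_ne_zero_of_sum_ne_zero hne
  exact ⟨e, Finset.mem_filter.mp he⟩
end

section
/- Let D, N, M be natural numbers with M ≤ N ≤ D and M ≤ D - N. Then the following are equivalent: (i) there exists a finite family E of N-element subsets of Fin D in which any two distinct members intersect in strictly fewer than N - M elements, together with weights x : E → ℝ, x_e ≥ 0, satisfying the level-M uniformity condition ∑_{e ∈ E, S ⊆ e} x_e = (N.choose M : ℝ) / (D.choose M) for every M-element subset S of Fin D; (ii) there exists a finite family E' of (D - N)-element subsets of Fin D in which any two distinct members intersect in strictly fewer than (D - N) - M elements, together with weights x' : E' → ℝ, x'_e ≥ 0, satisfying ∑_{e ∈ E', S ⊆ e} x'_e = ((D - N).choose M : ℝ) / (D.choose M) for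 every M-element subset S of Fin D. -/
section WeightedSetFamily

variable {α : Type*} [Fintype α] [DecidableEq α] {E : Finset (Finset α)} {x : Finset α → ℝ}
  {N M : ℕ} {c : ℝ}

/-- Double counting of the pairs `(a, e)` with `a ∉ S` and `insert a S ⊆ e`. -/
lemma sum_compl_sum_insert_subset (hE : ∀ e ∈ E, e.card = N) (S : Finset α) :
    ∑ a ∈ Sᶜ, ∑ e ∈ E.filter (fun e => insert a S ⊆ e), x e =
      ((N : ℝ) - S.card) * ∑ e ∈ E.filter (fun e => S ⊆ e), x e := by
  have hswap : ∑ a ∈ Sᶜ, ∑ e ∈ E.filter (fun e => insert a S ⊆ e), x e =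
      ∑ e ∈ E.filter (fun e => S ⊆ e), ∑ _a ∈ e \ S, x e := by
    refine Finset.sum_comm' fun a e => ?_
    simp only [Finset.mem_compl, Finset.mem_filter, Finset.mem_sdiff, Finset.insert_subset_iff]
    tauto
  rw [hswap, Finset.mul_sum]
  refine Finset.sum_congr rfl fun e he => ?_
  obtain ⟨heE, hSe⟩ := Finset.mem_filter.mp he
  rw [Finset.sum_const, nsmul_eq_mul, Finset.cast_card_sdiff hSe, hE e heE]

/-- Uniformity on `M`-sets propagates to all smaller sets. -/
lemma sum_filter_subset_of_card_le (hMN : M ≤ N) (hN : N ≤ Fintype.card α)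
    (hE : ∀ e ∈ E, e.card = N)
    (hx : ∀ S : Finset α, S.card = M → ∑ e ∈ E.filter (fun e => S ⊆ e), x e =
      c * (Fintype.card α - M).choose (N - M))
    (S : Finset α) (hS : S.card ≤ M) :
    ∑ e ∈ E.filter (fun e => S ⊆ e), x e =
      c * (Fintype.card α - S.card).choose (N - S.card) := by
  induction hk : M - S.card generalizing S with
  | zero =>
    have h : S.card = M := by omega
    rw [hx S h, h]
  | succ k ih =>
    have hcount := sum_compl_sum_insert_subset (x := x) hE S
    have hinsert : ∀ a ∈ Sᶜ, ∑ e ∈ E.filter (fun e => insert a S ⊆ e), x e =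
        c * (Fintype.card α - (S.card + 1)).choose (N - (S.card + 1)) := fun a ha => by
      have hcard := Finset.card_insert_of_notMem (Finset.mem_compl.mp ha)
      rw [ih (insert a S) (by omega) (by omega), hcard]
    rw [Finset.sum_congr rfl hinsert, Finset.sum_const, nsmul_eq_mul, Finset.card_compl] at hcount
    obtain ⟨m, hm⟩ := Nat.exists_eq_add_of_le (show S.card + 1 ≤ N by omega)
    obtain ⟨n, hn⟩ := Nat.exists_eq_add_of_le (show S.card + 1 ≤ Fintype.card α by omega)
    have hchoose := Nat.add_one_mul_choose_eq n m
    rw [show Fintype.card α - S.card = n + 1 by omega,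
      show Fintype.card α - (S.card + 1) = n by omega,
      show N - (S.card + 1) = m by omega] at hcount
    rw [show Fintype.card α - S.card = n + 1 by omega, show N - S.card = m + 1 by omega]
    have hNm : (N : ℝ) - S.card = m + 1 := by rw [hm]; push_cast; ring
    rw [hNm] at hcount
    have hpos : (m + 1 : ℝ) ≠ 0 := by positivity
    apply mul_left_cancel₀ hpos
    rw [← hcount]
    have hchoose' : ((n : ℝ) + 1) * n.choose m = (n + 1).choose (m + 1) * (m + 1) := by
      exact_mod_cast hchoose
    push_cast
    linear_combination c * hchoose'

/-- Under level-`M` uniformity, the total weight of the members containing `T` and avoiding `U`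
depends only on the sizes of `T` and `U`, as long as these add up to at most `M`. -/
lemma sum_filter_subset_disjoint (hMN : M ≤ N) (hN : N ≤ Fintype.card α)
    (hE : ∀ e ∈ E, e.card = N)
    (hx : ∀ S : Finset α, S.card = M → ∑ e ∈ E.filter (fun e => S ⊆ e), x e =
      c * (Fintype.card α - M).choose (N - M))
    (T U : Finset α) (hTU : Disjoint T U) (hcard : T.card + U.card ≤ M) :
    ∑ e ∈ E.filter (fun e => T ⊆ e ∧ Disjoint U e), x e =
      c * (Fintype.card α - T.card - U.card).choose (N - T.card) := by
  induction U using Finset.induction_on generalizing T with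
  | empty =>
    simpa using sum_filter_subset_of_card_le hMN hN hE hx T (by simpa using hcard)
  | insert a U ha ih =>
    rw [Finset.card_insert_of_notMem ha] at hcard ⊢
    obtain ⟨haT, hTU⟩ := Finset.disjoint_insert_right.mp hTU
    have hT := ih T hTU (by omega)
    have hins := ih (insert a T) (Finset.disjoint_insert_left.mpr ⟨ha, hTU⟩)
      (by rw [Finset.card_insert_of_notMem haT]; omega)
    rw [Finset.card_insert_of_notMem haT] at hins
    rw [← Finset.sum_filter_add_sum_filter_not _ (fun e => a ∈ e), Finset.filter_filter,
      Finset.filter_filter] at hT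
    have h₁ : E.filter (fun e => (T ⊆ e ∧ Disjoint U e) ∧ a ∈ e) =
        E.filter (fun e => insert a T ⊆ e ∧ Disjoint U e) :=
      Finset.filter_congr fun e _ => by rw [Finset.insert_subset_iff]; tauto
    have h₂ : E.filter (fun e => (T ⊆ e ∧ Disjoint U e) ∧ a ∉ e) =
        E.filter (fun e => T ⊆ e ∧ Disjoint (insert a U) e) :=
      Finset.filter_congr fun e _ => by rw [Finset.disjoint_insert_left]; tauto
    rw [h₁, h₂, hins] at hT
    obtain ⟨m, hm⟩ := Nat.exists_eq_add_of_le (show T.card + 1 ≤ N by omega)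
    obtain ⟨n, hn⟩ := Nat.exists_eq_add_of_le
      (show T.card + U.card + 1 ≤ Fintype.card α by omega)
    rw [show Fintype.card α - (T.card + 1) - U.card = n by omega,
      show N - (T.card + 1) = m by omega, show Fintype.card α - T.card - U.card = n + 1 by omega,
      show N - T.card = m + 1 by omega, Nat.choose_succ_succ] at hT
    rw [show Fintype.card α - T.card - (U.card + 1) = n by omega,
      show N - T.card = m + 1 by omega]
    push_cast at hT
    linear_combination hT

end WeightedSetFamily

lemma choose_div_choose_eq {D N M : ℕ} (hMN : M ≤ N) (hND : N ≤ D) :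
    (N.choose M : ℝ) / D.choose M = (D.choose N : ℝ)⁻¹ * (D - M).choose (N - M) := by
  have hM : (D.choose M : ℝ) ≠ 0 := by exact_mod_cast (Nat.choose_pos (hMN.trans hND)).ne'
  have hN : (D.choose N : ℝ) ≠ 0 := by exact_mod_cast (Nat.choose_pos hND).ne'
  have h : (D.choose N : ℝ) * N.choose M = D.choose M * (D - M).choose (N - M) := by
    exact_mod_cast Nat.choose_mul hMN
  field_simp
  linear_combination h

/-- Taking complements of edges turns a maximally `M`-body entangled `N`-fermion family into a
`(D - N)`-fermion one. -/
lemma exists_complement_family {D N M : ℕ} (hMN : M ≤ N) (hND : N ≤ D) (hM : M ≤ D - N)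
    (h : ∃ (E : Finset (Finset (Fin D))) (x : Finset (Fin D) → ℝ),
      (∀ e ∈ E, e.card = N) ∧
      (∀ e₁ ∈ E, ∀ e₂ ∈ E, e₁ ≠ e₂ → (e₁ ∩ e₂).card < N - M) ∧
      (∀ e ∈ E, 0 ≤ x e) ∧
      (∀ S : Finset (Fin D), S.card = M →
        ∑ e ∈ E.filter (fun e => S ⊆ e), x e = (N.choose M : ℝ) / (D.choose M))) :
    ∃ (E' : Finset (Finset (Fin D))) (x' : Finset (Fin D) → ℝ),
      (∀ e ∈ E', e.card = D - N) ∧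
      (∀ e₁ ∈ E', ∀ e₂ ∈ E', e₁ ≠ e₂ → (e₁ ∩ e₂).card < (D - N) - M) ∧
      (∀ e ∈ E', 0 ≤ x' e) ∧
      (∀ S : Finset (Fin D), S.card = M →
        ∑ e ∈ E'.filter (fun e => S ⊆ e), x' e =
          ((D - N).choose M : ℝ) / (D.choose M)) := by
  obtain ⟨E, x, hE, hoverlap, hnonneg, hx⟩ := h
  refine ⟨E.image compl, fun e => x eᶜ, ?_, ?_, ?_, fun S hS => ?_⟩
  · simp only [Finset.forall_mem_image]
    intro e he
    rw [Finset.card_compl, hE e he, Fintype.card_fin]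
  · simp only [Finset.forall_mem_image]
    intro e₁ he₁ e₂ he₂ hne
    have hlt := hoverlap e₁ he₁ e₂ he₂ fun h => hne (h ▸ rfl)
    have hunion := Finset.card_union_add_card_inter e₁ e₂
    have hle := Finset.card_le_univ (e₁ ∪ e₂)
    rw [hE e₁ he₁, hE e₂ he₂] at hunion
    rw [Fintype.card_fin] at hle
    rw [← Finset.compl_union, Finset.card_compl, Fintype.card_fin]
    omega
  · simp only [Finset.forall_mem_image, compl_compl]
    exact hnonneg
  · have hsum : ∑ e ∈ (E.image compl).filter (fun e => S ⊆ e), x eᶜ =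
        ∑ e ∈ E.filter (fun e => ∅ ⊆ e ∧ Disjoint S e), x e := by
      refine Finset.sum_nbij' compl compl ?_ ?_ ?_ ?_ ?_ <;>
        simp +contextual [Finset.subset_compl_iff_disjoint_right, disjoint_compl_right_iff]
    have key := sum_filter_subset_disjoint (x := x) (c := (D.choose N : ℝ)⁻¹) hMN
      (by simpa using hND) hE
      (fun S hS => by rw [hx S hS, Fintype.card_fin, choose_div_choose_eq hMN hND])
      ∅ S (Finset.disjoint_empty_left S) (by simp [hS])
    rw [hsum, key, choose_div_choose_eq hM (Nat.sub_le D N), Nat.choose_symm hND,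
      Nat.sub_right_comm D N M, Nat.choose_symm (show N ≤ D - M by omega)]
    simp only [Finset.card_empty, Nat.sub_zero, Fintype.card_fin, hS]


/-- Particle-hole symmetry of maximally `M`-body entangled states: a family of
`N`-element edges satisfying the overlap criterion with nonnegative weights
meeting the level-`M` uniformity condition exists iff the analogous data exists
for `(D - N)`-element edges. -/
theorem particle_hole_existence (D N M : ℕ) (hMN : M ≤ N) (hND : N ≤ D)
    (hM : M ≤ D - N) :
    (∃ (E : Finset (Finset (Fin D))) (x : Finset (Fin D) → ℝ),
      (∀ e ∈ E, e.card = N) ∧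
      (∀ e₁ ∈ E, ∀ e₂ ∈ E, e₁ ≠ e₂ → (e₁ ∩ e₂).card < N - M) ∧
      (∀ e ∈ E, 0 ≤ x e) ∧
      (∀ S : Finset (Fin D), S.card = M →
        ∑ e ∈ E.filter (fun e => S ⊆ e), x e =
          (N.choose M : ℝ) / (D.choose M))) ↔
    (∃ (E' : Finset (Finset (Fin D))) (x' : Finset (Fin D) → ℝ),
      (∀ e ∈ E', e.card = D - N) ∧
      (∀ e₁ ∈ E', ∀ e₂ ∈ E', e₁ ≠ e₂ → (e₁ ∩ e₂).card < (D - N) - M) ∧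
      (∀ e ∈ E', 0 ≤ x' e) ∧
      (∀ S : Finset (Fin D), S.card = M →
        ∑ e ∈ E'.filter (fun e => S ⊆ e), x' e =
          ((D - N).choose M : ℝ) / (D.choose M))) := by
  refine ⟨exists_complement_family hMN hND hM, fun h => ?_⟩
  have h' := exists_complement_family hM (Nat.sub_le D N) (by omega) h
  rwa [Nat.sub_sub_self hND] at h'
end
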